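/- Let ι be a finite index set, for each i ∈ ι let Rᵢ be a finite commutative local ring with Jacobson radical Jᵢ, and set qᵢ = |Rᵢ|/|Jᵢ|. Let R = ∏ᵢ Rᵢ and let S be a k-clique in the distant graph of R. Then the number of points x ∈ P(R) that are distant to every point of S (equivalently, the number of (k+1)-cliques containing S) equals ∏ᵢ ( |Jᵢ| · (qᵢ + 1 − k) ). -/

import Mathlib

/-- A pair is admissible if it is the first row of some invertible 2×2 matrix. -/
def Admissible (R : Type*) [Ring R] (v : R × R) : Prop :=
  ∃ M : Matrix (Fin 2) (Fin 2) R, IsUnit M ∧ M 0 0 = v.1 ∧ M 0 1 = v.2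

/-- The type of admissible pairs. -/
def AdmissiblePair (R : Type*) [Ring R] := {v : R × R // Admissible R v}

/-- Two admissible pairs are associated if one is obtained from the other by left
multiplication by a unit. -/
def ProjAssoc (R : Type*) [Ring R] (v w : AdmissiblePair R) : Prop :=
  ∃ u : Rˣ, v.1.1 = (u : R) * w.1.1 ∧ v.1.2 = (u : R) * w.1.2

/-- The projective line over a ring: admissible pairs modulo unit multiples. -/
def ProjLine (R : Type*) [Ring R] := Quot (ProjAssoc R)

/-- The point of the projective line determined by an admissible pair. -/
def ProjLine.mk (R : Type*) [Ring R] (v : AdmissiblePair R) : ProjLine R :=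
  Quot.mk (ProjAssoc R) v

/-- Two points are distant if (for some, equivalently any, representatives) the 2×2 matrix
formed from the representatives is invertible. -/
def Distant (R : Type*) [Ring R] (x y : ProjLine R) : Prop :=
  ∃ (a b c d : R) (h₁ : Admissible R (a, b)) (h₂ : Admissible R (c, d)),
    x = ProjLine.mk R ⟨(a, b), h₁⟩ ∧ y = ProjLine.mk R ⟨(c, d), h₂⟩ ∧
    IsUnit !![a, b; c, d]

/-- The determinant of the 2×2 matrix with rows `v` and `w`. -/
def rowDet {R : Type*} [CommRing R] (v w : R × R) : R := v.1 * w.2 - v.2 * w.1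

theorem rowDet_smul_left {R : Type*} [CommRing R] (u : R) (v w : R × R) :
    rowDet (u • v) w = u * rowDet v w := by
  simp [rowDet]; ring

theorem rowDet_smul_right {R : Type*} [CommRing R] (u : R) (v w : R × R) :
    rowDet v (u • w) = u * rowDet v w := by
  simp [rowDet]; ring

theorem admissible_iff_exists_isUnit_rowDet {R : Type*} [CommRing R] (v : R × R) :
    Admissible R v ↔ ∃ w : R × R, IsUnit (rowDet v w) := by
  constructor
  · rintro ⟨M, hM, h0, h1⟩
    refine ⟨(M 1 0, M 1 1), ?_⟩
    rw [Matrix.isUnit_iff_isUnit_det, Matrix.det_fin_two, h0, h1] at hM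
    exact hM
  · rintro ⟨w, hw⟩
    refine ⟨!![v.1, v.2; w.1, w.2], ?_, rfl, rfl⟩
    rw [Matrix.isUnit_iff_isUnit_det, Matrix.det_fin_two_of]
    exact hw

theorem projAssoc_iff_exists_smul {R : Type*} [CommRing R] (v w : AdmissiblePair R) :
    ProjAssoc R v w ↔ ∃ u : Rˣ, v.1 = (u : R) • w.1 := by
  simp [ProjAssoc, Prod.ext_iff]

theorem projAssoc_equivalence (R : Type*) [CommRing R] : Equivalence (ProjAssoc R) where
  refl v := (projAssoc_iff_exists_smul v v).2 ⟨1, by simp⟩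
  symm {v w} h := by
    obtain ⟨u, hu⟩ := (projAssoc_iff_exists_smul v w).1 h
    exact (projAssoc_iff_exists_smul w v).2 ⟨u⁻¹, by rw [hu, smul_smul]; simp⟩
  trans {v w x} h h' := by
    obtain ⟨u, hu⟩ := (projAssoc_iff_exists_smul v w).1 h
    obtain ⟨t, ht⟩ := (projAssoc_iff_exists_smul w x).1 h'
    exact (projAssoc_iff_exists_smul v x).2 ⟨u * t, by rw [hu, ht, smul_smul]; simp⟩

theorem ProjLine.mk_eq_mk_iff {R : Type*} [CommRing R] (v w : AdmissiblePair R) :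
    ProjLine.mk R v = ProjLine.mk R w ↔ ∃ u : Rˣ, v.1 = (u : R) • w.1 := by
  rw [← projAssoc_iff_exists_smul]
  exact ⟨fun h => Quotient.exact (s := ⟨_, projAssoc_equivalence R⟩) h, fun h => Quot.sound h⟩

theorem distant_mk_iff {R : Type*} [CommRing R] (v w : AdmissiblePair R) :
    Distant R (ProjLine.mk R v) (ProjLine.mk R w) ↔ IsUnit (rowDet v.1 w.1) := by
  constructor
  · rintro ⟨a, b, c, d, h₁, h₂, hv, hw, h⟩
    obtain ⟨u, hu⟩ := (ProjLine.mk_eq_mk_iff _ _).1 hv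
    obtain ⟨t, ht⟩ := (ProjLine.mk_eq_mk_iff _ _).1 hw
    rw [Matrix.isUnit_iff_isUnit_det, Matrix.det_fin_two_of] at h
    rw [hu, ht, rowDet_smul_left, rowDet_smul_right]
    exact u.isUnit.mul (t.isUnit.mul h)
  · intro h
    refine ⟨v.1.1, v.1.2, w.1.1, w.1.2, v.2, w.2, rfl, rfl, ?_⟩
    rw [Matrix.isUnit_iff_isUnit_det, Matrix.det_fin_two_of]
    exact h

theorem Admissible.smul_left_injective {R : Type*} [CommRing R] {v : R × R}
    (hv : Admissible R v) {s t : R} (h : s • v = t • v) : s = t := by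
  obtain ⟨w, hw⟩ := (admissible_iff_exists_isUnit_rowDet v).1 hv
  have := congrArg (rowDet · w) h
  simp only [rowDet_smul_left] at this
  exact hw.mul_right_cancel this

theorem Admissible.units_smul {R : Type*} [CommRing R] {v : R × R}
    (hv : Admissible R v) (u : Rˣ) : Admissible R ((u : R) • v) := by
  obtain ⟨w, hw⟩ := (admissible_iff_exists_isUnit_rowDet v).1 hv
  refine (admissible_iff_exists_isUnit_rowDet _).2 ⟨w, ?_⟩
  rw [rowDet_smul_left]
  exact u.isUnit.mul hw

theorem card_admissible_eq_card_units_mul {R : Type*} [CommRing R] (p : ProjLine R → Prop) :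
    Nat.card {v : AdmissiblePair R // p (ProjLine.mk R v)} =
      Nat.card Rˣ * Nat.card {x : ProjLine R // p x} := by
  rw [← Nat.card_prod]
  have hout : ∀ x : ProjLine R, ProjLine.mk R (Quot.out x) = x := Quot.out_eq
  have hmk (u : Rˣ) (v : AdmissiblePair R) :
      ProjLine.mk R ⟨(u : R) • v.1, v.2.units_smul u⟩ = ProjLine.mk R v :=
    (ProjLine.mk_eq_mk_iff _ _).2 ⟨u, rfl⟩
  symm
  refine Nat.card_eq_of_bijective
    (fun z => ⟨⟨(z.1 : R) • (Quot.out z.2.1).1, (Quot.out z.2.1).2.units_smul z.1⟩, by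
      rw [hmk, hout]; exact z.2.2⟩) ⟨?_, ?_⟩
  · rintro ⟨u, x, hx⟩ ⟨t, y, hy⟩ h
    have h' := congrArg Subtype.val h
    have hxy : x = y := by
      have := congrArg (ProjLine.mk R) h'
      rwa [hmk, hmk, hout, hout] at this
    subst hxy
    have := (Quot.out x).2.smul_left_injective (congrArg Subtype.val h')
    have hut : u = t := Units.ext this
    rw [hut]
  · rintro ⟨v, hv⟩
    obtain ⟨u, hu⟩ := (ProjLine.mk_eq_mk_iff v (Quot.out (ProjLine.mk R v))).1 (hout _).symm
    exact ⟨(u, ⟨ProjLine.mk R v, hv⟩), Subtype.ext (Subtype.ext hu.symm)⟩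

theorem AddMonoidHom.card_preimage_of_surjective {G H : Type*} [AddGroup G] [AddGroup H]
    (f : G →+ H) (hf : Function.Surjective f) (B : Set H) :
    Nat.card (f ⁻¹' B) = Nat.card f.ker * Nat.card B := by
  rw [← Nat.card_prod]
  symm
  refine Nat.card_eq_of_bijective
    (fun z => ⟨z.1.1 + Function.surjInv hf z.2.1, by
      have : f z.1.1 = 0 := z.1.2
      simp [this, Function.surjInv_eq hf]⟩) ⟨?_, ?_⟩
  · rintro ⟨⟨a, ha⟩, b, hb⟩ ⟨⟨c, hc⟩, d, hd⟩ h
    have h' := congrArg Subtype.val h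
    simp only at h'
    have ha' : f a = 0 := ha
    have hc' : f c = 0 := hc
    have hbd : b = d := by
      simpa [ha', hc', Function.surjInv_eq hf] using congrArg f h'
    subst hbd
    simpa using h'
  · rintro ⟨g, hg⟩
    refine ⟨(⟨g - Function.surjInv hf (f g), ?_⟩, ⟨f g, hg⟩), ?_⟩
    · simp [AddMonoidHom.mem_ker, Function.surjInv_eq hf]
    · simp

theorem rowDet_eq_zero_iff_exists_smul {F : Type*} [Field F] {v w : F × F} (hw : w ≠ 0) :
    rowDet v w = 0 ↔ ∃ u : F, v = u • w := by
  constructor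
  · intro h
    have h' : v.1 * w.2 = v.2 * w.1 := sub_eq_zero.1 h
    by_cases h1 : w.1 = 0
    · have h2 : w.2 ≠ 0 := fun h2 => hw (Prod.ext h1 h2)
      refine ⟨v.2 / w.2, Prod.ext ?_ ?_⟩
      · simpa [h1, h2] using h'
      · simp [h2]
    · refine ⟨v.1 / w.1, Prod.ext ?_ ?_⟩
      · simp [h1]
      · simp only [Prod.smul_snd, smul_eq_mul]
        field_simp
        linear_combination -h'
  · rintro ⟨u, rfl⟩
    simp only [rowDet, Prod.smul_fst, Prod.smul_snd, smul_eq_mul]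
    ring

theorem card_off_lines {F σ : Type*} [Field F] [Finite F] [Finite σ] (w : σ → F × F)
    (hw : ∀ s, w s ≠ 0) (hdet : ∀ s t, s ≠ t → rowDet (w s) (w t) ≠ 0) :
    Nat.card {v : F × F | v ≠ 0 ∧ ∀ s, rowDet v (w s) ≠ 0} =
      (Nat.card F - 1) * (Nat.card F + 1 - Nat.card σ) := by
  set B : Set (F × F) := {v | v ≠ 0 ∧ ∀ s, rowDet v (w s) ≠ 0} with hB
  let g : Option (σ × Fˣ) → F × F := fun o => o.elim 0 fun z => (z.2 : F) • w z.1
  have hg0 (z : σ × Fˣ) : (z.2 : F) • w z.1 ≠ 0 := smul_ne_zero z.2.ne_zero (hw _)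
  have hg : Function.Injective g := by
    rintro (_ | ⟨s, u⟩) (_ | ⟨t, u'⟩) h
    · rfl
    · exact absurd h.symm (hg0 (t, u'))
    · exact absurd h (hg0 (s, u))
    · have h' : (u : F) • w s = (u' : F) • w t := h
      have hst : s = t := by
        by_contra hst
        have h0 : rowDet ((u : F) • w s) (w t) = 0 :=
          (rowDet_eq_zero_iff_exists_smul (hw t)).2 ⟨u', h'⟩
        rw [rowDet_smul_left] at h0
        exact mul_ne_zero u.ne_zero (hdet s t hst) h0
      subst hst
      rw [Units.ext (smul_left_injective F (hw s) h')]
  have hrange : Set.range g = Bᶜ := by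
    ext v
    constructor
    · rintro ⟨_ | ⟨s, u⟩, rfl⟩ ⟨h1, h2⟩
      · exact h1 rfl
      · exact h2 s ((rowDet_eq_zero_iff_exists_smul (hw s)).2 ⟨u, rfl⟩)
    · intro hv
      by_cases h0 : v = 0
      · exact ⟨none, h0.symm⟩
      · have : ∃ s, rowDet v (w s) = 0 := by
          by_contra! h
          exact hv ⟨h0, h⟩
        obtain ⟨s, hs⟩ := this
        obtain ⟨u, rfl⟩ := (rowDet_eq_zero_iff_exists_smul (hw s)).1 hs
        have hu : u ≠ 0 := fun hu => h0 (by simp [hu])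
        exact ⟨some (s, Units.mk0 u hu), rfl⟩
  have hcompl : Nat.card (Bᶜ : Set (F × F)) = Nat.card σ * (Nat.card F - 1) + 1 := by
    rw [← hrange, Nat.card_range_of_injective hg, Finite.card_option, Nat.card_prod,
      Nat.card_units]
  have htotal : Nat.card B + Nat.card (Bᶜ : Set (F × F)) = Nat.card F * Nat.card F := by
    rw [← Nat.card_prod]
    exact Set.ncard_add_ncard_compl B
  obtain ⟨m, hm⟩ : ∃ m, Nat.card F = m + 1 := ⟨_, (Nat.succ_pred_eq_of_pos Nat.card_pos).symm⟩
  rw [hcompl, hm] at htotal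
  rw [hm, Nat.mul_sub]
  simp only [Nat.add_sub_cancel] at htotal ⊢
  apply Nat.eq_sub_of_add_eq
  linarith

section LocalRing

open IsLocalRing

variable {R : Type*} [CommRing R] [IsLocalRing R]

theorem IsLocalRing.card_eq_card_maximalIdeal_mul :
    Nat.card R = Nat.card (maximalIdeal R) * Nat.card (ResidueField R) := by
  have := (residue R).toAddMonoidHom.card_preimage_of_surjective residue_surjective Set.univ
  rw [Set.preimage_univ, Nat.card_univ, Nat.card_univ] at this
  rw [this, ← ker_residue]
  rfl

theorem IsLocalRing.card_units :
    Nat.card Rˣ = Nat.card (maximalIdeal R) * (Nat.card (ResidueField R) - 1) := by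
  have h := (residue R).toAddMonoidHom.card_preimage_of_surjective residue_surjective
    {x | x ≠ 0}
  have h1 : Nat.card {x : ResidueField R | x ≠ 0} = Nat.card (ResidueField R) - 1 := by
    rw [← Nat.card_units]
    exact Nat.card_congr unitsEquivNeZero.symm
  have h2 : Nat.card ((residue R).toAddMonoidHom ⁻¹' {x | x ≠ 0}) = Nat.card Rˣ := by
    symm
    refine Nat.card_eq_of_bijective
      (fun u => ⟨u, (residue_ne_zero_iff_isUnit (u : R)).2 u.isUnit⟩) ⟨?_, ?_⟩
    · intro u t h
      exact Units.ext (congrArg Subtype.val h)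
    · rintro ⟨x, hx⟩
      obtain ⟨u, rfl⟩ := (residue_ne_zero_iff_isUnit x).1 hx
      exact ⟨u, rfl⟩
  rw [← h2, h, h1, ← ker_residue]
  rfl

theorem IsLocalRing.isUnit_rowDet_iff (v w : R × R) :
    IsUnit (rowDet v w) ↔
      rowDet (Prod.map (residue R) (residue R) v) (Prod.map (residue R) (residue R) w) ≠ 0 := by
  rw [← residue_ne_zero_iff_isUnit]
  simp [rowDet]

theorem IsLocalRing.exists_isUnit_rowDet_iff (v : R × R) :
    (∃ w, IsUnit (rowDet v w)) ↔ Prod.map (residue R) (residue R) v ≠ 0 := by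
  constructor
  · rintro ⟨w, hw⟩ h0
    rw [isUnit_rowDet_iff, h0] at hw
    simp [rowDet] at hw
  · intro h
    by_cases h1 : residue R v.1 = 0
    · have h2 : residue R v.2 ≠ 0 := fun h2 => h (Prod.ext h1 h2)
      exact ⟨(-1, 0), by simpa [rowDet] using (residue_ne_zero_iff_isUnit _).1 h2⟩
    · exact ⟨(0, 1), by simpa [rowDet] using (residue_ne_zero_iff_isUnit _).1 h1⟩

theorem IsLocalRing.card_isUnit_rowDet [Finite R] {σ : Type*} [Finite σ] (w : σ → R × R)
    (hw : ∀ s, ∃ t, IsUnit (rowDet (w s) t))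
    (hdet : ∀ s t, s ≠ t → IsUnit (rowDet (w s) (w t))) :
    Nat.card {v : R × R // (∃ t, IsUnit (rowDet v t)) ∧ ∀ s, IsUnit (rowDet v (w s))} =
      Nat.card Rˣ * (Nat.card (maximalIdeal R) *
        (Nat.card (ResidueField R) + 1 - Nat.card σ)) := by
  have : Finite (ResidueField R) := Finite.of_surjective _ (residue_surjective (R := R))
  let f : R × R →+ ResidueField R × ResidueField R :=
    (residue R).toAddMonoidHom.prodMap (residue R).toAddMonoidHom
  have hf : Function.Surjective f :=
    Function.Surjective.prodMap residue_surjective residue_surjective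
  have hker : Nat.card f.ker = Nat.card (maximalIdeal R) * Nat.card (maximalIdeal R) := by
    have h := f.card_preimage_of_surjective hf Set.univ
    rw [Set.preimage_univ, Nat.card_univ, Nat.card_univ, Nat.card_prod, Nat.card_prod,
      card_eq_card_maximalIdeal_mul (R := R)] at h
    have hpos : 0 < Nat.card (ResidueField R) * Nat.card (ResidueField R) :=
      Nat.mul_pos Nat.card_pos Nat.card_pos
    exact Nat.eq_of_mul_eq_mul_right hpos (by rw [← h]; ring)
  have hoff := card_off_lines (fun s => f (w s))
    (fun s => (exists_isUnit_rowDet_iff (w s)).1 (hw s))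
    (fun s t hst => (isUnit_rowDet_iff _ _).1 (hdet s t hst))
  have hpre := f.card_preimage_of_surjective hf {v | v ≠ 0 ∧ ∀ s, rowDet v (f (w s)) ≠ 0}
  rw [hoff, hker] at hpre
  rw [card_units]
  have hset : Nat.card {v : R × R // (∃ t, IsUnit (rowDet v t)) ∧
      ∀ s, IsUnit (rowDet v (w s))} =
      Nat.card (f ⁻¹' {v | v ≠ 0 ∧ ∀ s, rowDet v (f (w s)) ≠ 0}) := by
    refine Nat.card_congr (Equiv.subtypeEquivRight fun v => ?_)
    exact and_congr (exists_isUnit_rowDet_iff v)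
      (forall_congr' fun s => isUnit_rowDet_iff v (w s))
  rw [hset, hpre]
  ring

end LocalRing

theorem isUnit_rowDet_pi_iff {ι : Type*} {R : ι → Type*} [∀ i, CommRing (R i)]
    (v w : (∀ i, R i) × (∀ i, R i)) :
    IsUnit (rowDet v w) ↔ ∀ i, IsUnit (rowDet (v.1 i, v.2 i) (w.1 i, w.2 i)) :=
  Pi.isUnit_iff

theorem exists_isUnit_rowDet_pi_iff {ι : Type*} {R : ι → Type*} [∀ i, CommRing (R i)]
    (v : (∀ i, R i) × (∀ i, R i)) :
    (∃ w, IsUnit (rowDet v w)) ↔ ∀ i, ∃ t, IsUnit (rowDet (v.1 i, v.2 i) t) := by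
  simp only [isUnit_rowDet_pi_iff]
  constructor
  · rintro ⟨w, hw⟩ i
    exact ⟨_, hw i⟩
  · intro h
    choose t ht using h
    exact ⟨(fun i => (t i).1, fun i => (t i).2), ht⟩

/-- The number of points distant to every point of a given `k`-clique (equivalently, the
number of `(k+1)`-cliques containing it) in the distant graph of a finite direct product
of finite commutative local rings. -/
theorem count_clique_extensions_comm (ι : Type*) [Fintype ι] (R : ι → Type*)
    [∀ i, CommRing (R i)] [∀ i, Fintype (R i)] [∀ i, IsLocalRing (R i)]
    (J : ∀ i, Ideal (R i)) (hJ : ∀ i, J i = Ideal.jacobson (⊥ : Ideal (R i)))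
    (q : ι → ℕ) (hq : ∀ i, q i = Nat.card (R i) / Nat.card (J i)) (k : ℕ)
    (S : Finset (ProjLine (∀ i, R i))) (hcard : S.card = k)
    (hclique : ∀ x ∈ S, ∀ y ∈ S, x ≠ y → Distant (∀ i, R i) x y) :
    Nat.card {x : ProjLine (∀ i, R i) | ∀ y ∈ S, Distant (∀ i, R i) x y} =
      ∏ i, Nat.card (J i) * (q i + 1 - k) := by
  classical
  let w : S → (∀ i, R i) × (∀ i, R i) := fun y => (Quot.out y.1).1
  have hmk (y : S) : ProjLine.mk _ (Quot.out y.1) = y.1 := Quot.out_eq _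
  have hw (y : S) : ∃ t, IsUnit (rowDet (w y) t) :=
    (admissible_iff_exists_isUnit_rowDet _).1 (Quot.out y.1).2
  have hdet (y z : S) (hyz : y ≠ z) : IsUnit (rowDet (w y) (w z)) := by
    rw [← distant_mk_iff, hmk, hmk]
    exact hclique _ y.2 _ z.2 (fun h => hyz (Subtype.ext h))
  have hres (i : ι) : q i = Nat.card (IsLocalRing.ResidueField (R i)) := by
    rw [hq, hJ, IsLocalRing.jacobson_eq_maximalIdeal ⊥ bot_ne_top,
      IsLocalRing.card_eq_card_maximalIdeal_mul (R := R i)]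
    exact Nat.mul_div_cancel_left _ Nat.card_pos
  have hlocal (i : ι) := IsLocalRing.card_isUnit_rowDet
    (fun y : S => ((w y).1 i, (w y).2 i))
    (fun y => (exists_isUnit_rowDet_pi_iff _).1 (hw y) i)
    (fun y z hyz => (isUnit_rowDet_pi_iff _ _).1 (hdet y z hyz) i)
  have hunits : Nat.card (∀ i, R i)ˣ = ∏ i, Nat.card (R i)ˣ := by
    rw [Nat.card_congr MulEquiv.piUnits.toEquiv, Nat.card_pi]
  have hpairs : Nat.card {v : AdmissiblePair (∀ i, R i) //
      ∀ y ∈ S, Distant (∀ i, R i) (ProjLine.mk _ v) y} =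
      ∏ i, Nat.card {v : R i × R i // (∃ t, IsUnit (rowDet v t)) ∧
        ∀ y : S, IsUnit (rowDet v ((w y).1 i, (w y).2 i))} := by
    rw [← Nat.card_pi]
    have hdist (v : AdmissiblePair (∀ i, R i)) :
        (∀ y ∈ S, Distant (∀ i, R i) (ProjLine.mk _ v) y) ↔
          ∀ y : S, ∀ i, IsUnit (rowDet (v.1.1 i, v.1.2 i) ((w y).1 i, (w y).2 i)) := by
      refine Subtype.forall'.trans (forall_congr' fun y => ?_)
      rw [← isUnit_rowDet_pi_iff, ← hmk y, distant_mk_iff]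
    refine Nat.card_eq_of_bijective (fun v i => ⟨(v.1.1.1 i, v.1.1.2 i),
      (exists_isUnit_rowDet_pi_iff _).1
        ((admissible_iff_exists_isUnit_rowDet _).1 v.1.2) i,
      fun y => (hdist v.1).1 v.2 y i⟩) ⟨?_, ?_⟩
    · intro v v' h
      have h' (i : ι) := congrArg Subtype.val (congrFun h i)
      exact Subtype.ext (Subtype.ext (Prod.ext (funext fun i => congrArg Prod.fst (h' i))
        (funext fun i => congrArg Prod.snd (h' i))))
    · intro x
      refine ⟨⟨⟨(fun i => (x i).1.1, fun i => (x i).1.2), ?_⟩, ?_⟩, rfl⟩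
      · exact (admissible_iff_exists_isUnit_rowDet _).2
          ((exists_isUnit_rowDet_pi_iff _).2 fun i => (x i).2.1)
      · exact (hdist _).2 fun y i => (x i).2.2 y
  have hcount := card_admissible_eq_card_units_mul
    (fun x : ProjLine (∀ i, R i) => ∀ y ∈ S, Distant (∀ i, R i) x y)
  rw [hpairs, Finset.prod_congr rfl fun i _ => hlocal i, Finset.prod_mul_distrib, ← hunits]
    at hcount
  have hk : Nat.card S = k := by simp [hcard]
  rw [hk] at hcount
  refine (Nat.eq_of_mul_eq_mul_left Nat.card_pos hcount).symm.trans
    (Finset.prod_congr rfl fun i _ => ?_)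
  rw [hres, hJ, IsLocalRing.jacobson_eq_maximalIdeal ⊥ bot_ne_top]
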